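/- Let A be a unital C*-algebra. Then the tracial state space T(A), equipped with the weak* topology, satisfies the Riesz decomposition property for proper convex combinations: whenever τ = Σ_{j=1}^n α_j τ_j = Σ_{i=1}^m β_i σ_i are two proper convex combinations of tracial states, there exist γ_{ij} ≥ 0 and tracial states ρ_{ij} with τ = Σ γ_{ij} ρ_{ij}, α_j = Σ_i γ_{ij}, β_i = Σ_j γ_{ij}, τ_j = Σ_i α_j⁻¹ γ_{ij} ρ_{ij}, and σ_i = Σ_j β_i⁻¹ γ_{ij} ρ_{ij}. In particular, T(A) is a Choquet simplex (possibly empty). -/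

import Mathlib

open scoped ComplexOrder

/-- A tracial state on a unital C*-algebra `A`: a continuous linear functional with
`τ 1 = 1`, `τ (a* a) ≥ 0` and `τ (a b) = τ (b a)`. -/
def IsTracialState18 {A : Type*} [NormedRing A] [StarRing A] [NormedAlgebra ℂ A]
    (τ : A →L[ℂ] ℂ) : Prop :=
  τ 1 = 1 ∧ (∀ a : A, 0 ≤ τ (star a * a)) ∧ ∀ a b : A, τ (a * b) = τ (b * a)

open scoped InnerProductSpace

universe u

theorem aux_gns {A : Type u} [CStarAlgebra A] (f : A →ₗ[ℂ] ℂ)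
    (hf : ∀ a : A, 0 ≤ f (star a * a)) :
    ∃ (H : Type u) (_ : NormedAddCommGroup H) (_ : InnerProductSpace ℂ H) (_ : CompleteSpace H)
      (e : A →ₗ[ℂ] H) (π : A → H →L[ℂ] H), DenseRange e ∧
      (∀ a b, ⟪e a, e b⟫_ℂ = f (star a * b)) ∧ (∀ a b, π a (e b) = e (a * b)) ∧
      (∀ a x y, ⟪π a x, y⟫_ℂ = ⟪x, π (star a) y⟫_ℂ) := by
  letI : PartialOrder A := CStarAlgebra.spectralOrder A
  haveI : StarOrderedRing A := CStarAlgebra.spectralOrderedRing A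
  let g : A →ₚ[ℂ] ℂ := PositiveLinearMap.mk₀ f (by
    intro x hx
    obtain ⟨b, rfl⟩ := CStarAlgebra.nonneg_iff_eq_star_mul_self.mp hx
    exact hf b)
  refine ⟨g.GNS, inferInstance, inferInstance, inferInstance,
    (UniformSpace.Completion.toComplL (𝕜 := ℂ) (E := g.PreGNS)).toLinearMap ∘ₗ
      g.toPreGNS.toLinearMap, fun a => g.gnsStarAlgHom a, ?_, ?_, ?_, ?_⟩
  · exact UniformSpace.Completion.denseRange_coe.comp
      (f := fun x : A => (g.toPreGNS x)) (g.toPreGNS.surjective.denseRange)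
      (UniformSpace.Completion.continuous_coe _)
  · intro a b
    change ⟪((g.toPreGNS a : g.PreGNS) : g.GNS), ((g.toPreGNS b : g.PreGNS) : g.GNS)⟫_ℂ = _
    rw [UniformSpace.Completion.inner_coe, PositiveLinearMap.preGNS_inner_def]
    rfl
  · intro a b
    change g.gnsNonUnitalStarAlgHom a ((g.toPreGNS b : g.PreGNS) : g.GNS) = _
    rw [PositiveLinearMap.gnsNonUnitalStarAlgHom_apply_coe]
    rfl
  · intro a x y
    change ⟪g.gnsStarAlgHom a x, y⟫_ℂ = ⟪x, g.gnsStarAlgHom (star a) y⟫_ℂ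
    change ⟪g.gnsStarAlgHom a x, y⟫_ℂ = ⟪x, g.gnsStarAlgHom (star a) y⟫_ℂ
    rw [map_star, ContinuousLinearMap.star_eq_adjoint, ContinuousLinearMap.adjoint_inner_right]

/-- density induction for operator equality -/
theorem aux_ext {A H : Type u} [NormedAddCommGroup H] [InnerProductSpace ℂ H]
    {e : A → H} (he : DenseRange e) {S T : H →L[ℂ] H} 
    (h : ∀ a b, ⟪e b, S (e a)⟫_ℂ = ⟪e b, T (e a)⟫_ℂ) : S = T := by
  have h1 : ∀ a, S (e a) = T (e a) := by
    intro a
    apply ext_inner_left ℂ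
    intro v
    refine he.induction_on (p := fun v => ⟪v, S (e a)⟫_ℂ = ⟪v, T (e a)⟫_ℂ) v ?_ (fun b => h a b)
    exact isClosed_eq (by fun_prop) (by fun_prop)
  ext x
  exact he.induction_on (p := fun x => S x = T x) x 
    (isClosed_eq (by fun_prop) (by fun_prop)) h1

/-- Radon-Nikodym operator -/
theorem aux_rn {A H : Type u} [CStarAlgebra A] [NormedAddCommGroup H] [InnerProductSpace ℂ H]
    [CompleteSpace H] (f φ : A →ₗ[ℂ] ℂ) (hφ : ∀ a : A, 0 ≤ φ (star a * a))
    (hle : ∀ a : A, φ (star a * a) ≤ f (star a * a))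
    (e : A →ₗ[ℂ] H) (he : DenseRange e) (hin : ∀ a b, ⟪e a, e b⟫_ℂ = f (star a * b)) :
    ∃ h : H →L[ℂ] H, 0 ≤ h ∧ ∀ a b, ⟪e a, h (e b)⟫_ℂ = φ (star a * b) := by
  obtain ⟨K, _, _, _, d, -, -, hd, -, -⟩ := aux_gns φ hφ
  have hn : ∃ C : ℝ, ∀ x, ‖d x‖ ≤ C * ‖e x‖ := by
    refine ⟨1, fun x => ?_⟩
    rw [one_mul]
    have h1 := hle x
    rw [← hd, ← hin, inner_self_eq_norm_sq_to_K, inner_self_eq_norm_sq_to_K] at h1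
    have h2 : ‖d x‖ ^ 2 ≤ ‖e x‖ ^ 2 := by exact_mod_cast h1
    exact (sq_le_sq₀ (norm_nonneg _) (norm_nonneg _)).1 h2
  let V : H →L[ℂ] K := d.extendOfNorm e
  have hV : ∀ x, V (e x) = d x := fun x => LinearMap.extendOfNorm_eq he hn x
  refine ⟨V.adjoint ∘L V, ?_, fun a b => ?_⟩
  · rw [ContinuousLinearMap.nonneg_iff_isPositive]
    exact ContinuousLinearMap.isPositive_adjoint_comp_self V
  · rw [ContinuousLinearMap.comp_apply, ContinuousLinearMap.adjoint_inner_right, hV, hV, hd]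

theorem aux_star {A : Type u} [CStarAlgebra A] (f : A →ₗ[ℂ] ℂ)
    (hf : ∀ a : A, 0 ≤ f (star a * a)) (a : A) : f (star a) = star (f a) := by
  obtain ⟨H, _, _, _, e, -, -, hin, -, -⟩ := aux_gns f hf
  have h1 := hin a 1
  have h2 := hin 1 a
  simp only [mul_one, star_one, one_mul] at h1 h2
  rw [← h1, ← h2]
  exact (inner_conj_symm _ _).symm

theorem aux_J {A H : Type u} [CStarAlgebra A] [NormedAddCommGroup H] [InnerProductSpace ℂ H]
    [CompleteSpace H] (f : A →ₗ[ℂ] ℂ)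
    (htr : ∀ a b : A, f (a * b) = f (b * a))
    (e : A →ₗ[ℂ] H) (he : DenseRange e) (hin : ∀ a b, ⟪e a, e b⟫_ℂ = f (star a * b)) :
    ∃ J : H → H, Continuous J ∧ (∀ a, J (e a) = e (star a)) ∧ 
      ∀ x y, ⟪J x, J y⟫_ℂ = ⟪y, x⟫_ℂ := by
  let j : A →ₛₗ[starRingEnd ℂ] H :=
    { toFun := fun a => e (star a)
      map_add' := by intro a b; simp
      map_smul' := by intro a b; simp }
  have hj : ∀ a b, ⟪j a, j b⟫_ℂ = ⟪e b, e a⟫_ℂ := by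
    intro a b
    change ⟪e (star a), e (star b)⟫_ℂ = _
    rw [hin, hin, star_star, htr]
  have hn : ∃ C : ℝ, ∀ x, ‖j x‖ ≤ C * ‖e x‖ := by
    refine ⟨1, fun x => ?_⟩
    rw [one_mul]
    have h1 := hj x x
    rw [inner_self_eq_norm_sq_to_K, inner_self_eq_norm_sq_to_K] at h1
    have h2 : ‖j x‖ ^ 2 = ‖e x‖ ^ 2 := by exact_mod_cast h1
    exact (sq_le_sq₀ (norm_nonneg _) (norm_nonneg _)).1 h2.le
  let J : H →SL[starRingEnd ℂ] H := j.extendOfNorm e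
  have hJ : ∀ x, J (e x) = j x := fun x => LinearMap.extendOfNorm_eq he hn x
  refine ⟨J, J.continuous, hJ, ?_⟩
  intro x y
  have hc := J.continuous
  refine he.induction_on₂ (p := fun x y => ⟪J x, J y⟫_ℂ = ⟪y, x⟫_ℂ) ?_ ?_ x y
  · exact isClosed_eq (by fun_prop) (by fun_prop)
  · intro a b
    rw [hJ, hJ, hj]

/-- The data of a bimodule operator. -/
theorem aux_bimod {A H : Type u} [CStarAlgebra A] [NormedAddCommGroup H] [InnerProductSpace ℂ H]
    [CompleteSpace H] (φ : A →ₗ[ℂ] ℂ) (hφ : ∀ a : A, 0 ≤ φ (star a * a))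
    (htr : ∀ a b : A, φ (a * b) = φ (b * a))
    (e : A →ₗ[ℂ] H) (he : DenseRange e) (π : A → H →L[ℂ] H)
    (hπ : ∀ a b, π a (e b) = e (a * b))
    (hπs : ∀ a x y, ⟪π a x, y⟫_ℂ = ⟪x, π (star a) y⟫_ℂ)
    (J : H → H) (hJc : Continuous J) (hJ : ∀ a, J (e a) = e (star a))
    (hJi : ∀ x y, ⟪J x, J y⟫_ℂ = ⟪y, x⟫_ℂ)
    (h : H →L[ℂ] H) (hh : ∀ a b, ⟪e a, h (e b)⟫_ℂ = φ (star a * b)) :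
    (∀ a x, h (π a x) = π a (h x)) ∧ (∀ x, h (J x) = J (h x)) := by
  constructor
  · intro a x
    have : h ∘L π a = π a ∘L h := by
      apply aux_ext he
      intro b c
      have := hπs (star a) (e c) (h (e b))
      rw [star_star] at this
      simp only [ContinuousLinearMap.comp_apply]
      rw [← this, hπ, hπ, hh, hh, star_mul, star_star, mul_assoc]
    exact congrArg (fun T : H →L[ℂ] H => T x) this
  · have hJJ : ∀ x, J (J x) = x := fun x => 
      he.induction_on (p := fun x => J (J x) = x) x
        (isClosed_eq (by fun_prop) (by fun_prop)) (fun a => by rw [hJ, hJ, star_star])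
    intro x
    refine he.induction_on (p := fun x => h (J x) = J (h x)) x
        (isClosed_eq (by fun_prop) (by fun_prop)) (fun a => ?_)
    apply ext_inner_left ℂ
    intro v
    refine he.induction_on (p := fun v => ⟪v, h (J (e a))⟫_ℂ = ⟪v, J (h (e a))⟫_ℂ) v
      (isClosed_eq (by fun_prop) (by fun_prop)) (fun b => ?_)
    have h1 := hJi (e (star b)) (h (e a))
    rw [hJ, star_star] at h1
    rw [h1, hJ, hh, ← inner_conj_symm, hh, star_star, htr]
    have h3 := aux_star φ hφ (star a * star b)
    rw [htr (star a), star_mul, star_star, star_star] at h3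
    rw [htr (star a), h3]
    exact (star_star _).symm

theorem aux_comm {A H : Type u} [CStarAlgebra A] [NormedAddCommGroup H] [InnerProductSpace ℂ H]
    [CompleteSpace H]
    (e : A →ₗ[ℂ] H) (he : DenseRange e) (π : A → H →L[ℂ] H)
    (hπ : ∀ a b, π a (e b) = e (a * b))
    (hπs : ∀ a x y, ⟪π a x, y⟫_ℂ = ⟪x, π (star a) y⟫_ℂ)
    (J : H → H) (hJ : ∀ a, J (e a) = e (star a))
    (hJi : ∀ x y, ⟪J x, J y⟫_ℂ = ⟪y, x⟫_ℂ)
    (h k : H →L[ℂ] H)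
    (hs : ∀ x y, ⟪h x, y⟫_ℂ = ⟪x, h y⟫_ℂ) (ks : ∀ x y, ⟪k x, y⟫_ℂ = ⟪x, k y⟫_ℂ)
    (h1 : ∀ a x, h (π a x) = π a (h x)) (h2 : ∀ x, h (J x) = J (h x))
    (k1 : ∀ a x, k (π a x) = π a (k x)) (k2 : ∀ x, k (J x) = J (k x)) : 
    h * k = k * h := by
  have key : ∀ x, ⟪h (k (e 1)), e x⟫_ℂ = ⟪k (h (e 1)), e x⟫_ℂ := by
    intro x
    have hx : e x = π x (e 1) := by rw [hπ, mul_one]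
    have hJ1 : J (e 1) = e 1 := by rw [hJ, star_one]
    calc ⟪h (k (e 1)), e x⟫_ℂ = ⟪k (e 1), π x (h (e 1))⟫_ℂ := by rw [hs, hx, h1]
      _ = ⟪π (star x) (k (e 1)), h (e 1)⟫_ℂ := by rw [hπs, star_star]
      _ = ⟪J (k (e x)), J (h (e 1))⟫_ℂ := by
        rw [← k1, hπ, mul_one, ← k2, hJ, ← h2, hJ1]
      _ = ⟪k (h (e 1)), e x⟫_ℂ := by rw [hJi, ks]
  apply aux_ext he
  intro a b
  have hx : e a = π a (e 1) := by rw [hπ, mul_one]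
  change ⟪e b, h (k (e a))⟫_ℂ = ⟪e b, k (h (e a))⟫_ℂ
  rw [hx, k1, h1, h1, k1, ← inner_conj_symm, ← inner_conj_symm (e b), hπs, hπs, hπ, key]

theorem aux_main {A : Type u} [CStarAlgebra A] {ι κ : Type} [Fintype ι] [Fintype κ]
    (f : A →L[ℂ] ℂ) (φ : ι → A →L[ℂ] ℂ) (ψ : κ → A →L[ℂ] ℂ)
    (hf : ∀ a : A, 0 ≤ f (star a * a)) (hft : ∀ a b : A, f (a * b) = f (b * a))
    (hφ : ∀ i, ∀ a : A, 0 ≤ φ i (star a * a)) (hφt : ∀ i, ∀ a b : A, φ i (a * b) = φ i (b * a))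
    (hψ : ∀ i, ∀ a : A, 0 ≤ ψ i (star a * a)) (hψt : ∀ i, ∀ a b : A, ψ i (a * b) = ψ i (b * a))
    (h1 : ∀ a, f a = ∑ i, φ i a) (h2 : ∀ a, f a = ∑ i, ψ i a) :
    ∃ θ : ι → κ → A →L[ℂ] ℂ, (∀ i j, ∀ a : A, 0 ≤ θ i j (star a * a)) ∧ 
      (∀ i j, ∀ a b : A, θ i j (a * b) = θ i j (b * a)) ∧
      (∀ i j, θ i j 1 = 0 → ∀ a, θ i j a = 0) ∧
      (∀ i a, φ i a = ∑ j, θ i j a) ∧ (∀ j a, ψ j a = ∑ i, θ i j a) := by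
  obtain ⟨H, _, _, _, e, π, he, hin, hπ, hπs⟩ := aux_gns f.toLinearMap hf
  obtain ⟨J, hJc, hJ, hJi⟩ := aux_J f.toLinearMap hft e he hin
  have rn1 : ∀ i, ∃ h : H →L[ℂ] H, 0 ≤ h ∧ ∀ a b, ⟪e a, h (e b)⟫_ℂ = φ i (star a * b) := by
    intro i
    refine aux_rn f.toLinearMap (φ i).toLinearMap (hφ i) ?_ e he hin
    intro a
    change φ i (star a * a) ≤ f (star a * a)
    rw [h1]
    exact Finset.single_le_sum (f := fun i => φ i (star a * a)) (fun i _ => hφ i a)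
      (Finset.mem_univ i)
  have rn2 : ∀ i, ∃ h : H →L[ℂ] H, 0 ≤ h ∧ ∀ a b, ⟪e a, h (e b)⟫_ℂ = ψ i (star a * b) := by
    intro i
    refine aux_rn f.toLinearMap (ψ i).toLinearMap (hψ i) ?_ e he hin
    intro a
    change ψ i (star a * a) ≤ f (star a * a)
    rw [h2]
    exact Finset.single_le_sum (f := fun i => ψ i (star a * a)) (fun i _ => hψ i a)
      (Finset.mem_univ i)
  choose h hpos hh using rn1
  choose k kpos kk using rn2
  have hb := fun i => aux_bimod (φ i).toLinearMap (hφ i) (hφt i) e he π hπ hπs J hJc hJ hJi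
    (h i) (hh i)
  have kb := fun i => aux_bimod (ψ i).toLinearMap (hψ i) (hψt i) e he π hπ hπs J hJc hJ hJi
    (k i) (kk i)
  have symm : ∀ T : H →L[ℂ] H, 0 ≤ T → ∀ x y, ⟪T x, y⟫_ℂ = ⟪x, T y⟫_ℂ := by
    intro T hT
    rw [ContinuousLinearMap.nonneg_iff_isPositive] at hT
    exact hT.isSymmetric
  have comm : ∀ i j, h i * k j = k j * h i := fun i j =>
    aux_comm e he π hπ hπs J hJ hJi (h i) (k j) (symm _ (hpos i)) (symm _ (kpos j))
      (hb i).1 (hb i).2 (kb j).1 (kb j).2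
  have pos : ∀ i j, 0 ≤ h i * k j := fun i j => Commute.mul_nonneg (hpos i) (kpos j) (comm i j)
  have hsum : ∑ i, h i = 1 := by
    apply aux_ext he
    intro a b
    rw [ContinuousLinearMap.sum_apply, inner_sum, ContinuousLinearMap.one_apply, hin]
    simp only [hh]
    exact (h1 _).symm
  have ksum : ∑ i, k i = 1 := by
    apply aux_ext he
    intro a b
    rw [ContinuousLinearMap.sum_apply, inner_sum, ContinuousLinearMap.one_apply, hin]
    simp only [kk]
    exact (h2 _).symm
  -- continuity of e
  have hee : ∀ a b, e (a * b) = π a (e b) := fun a b => (hπ a b).symm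
  have eb : ∃ C, ∀ a, ‖e a‖ ≤ C * ‖a‖ := by
    refine ⟨Real.sqrt ‖f‖, fun a => ?_⟩
    have h3 : ‖e a‖ ^ 2 ≤ ‖f‖ * ‖a‖ ^ 2 := by
      have h4 : ‖⟪e a, e a⟫_ℂ‖ ≤ ‖f‖ * ‖star a * a‖ := by
        rw [hin]; exact f.le_opNorm _
      rw [CStarRing.norm_star_mul_self, inner_self_eq_norm_sq_to_K] at h4
      simpa [pow_two] using h4
    calc ‖e a‖ = √(‖e a‖ ^ 2) := (Real.sqrt_sq (norm_nonneg _)).symm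
      _ ≤ √(‖f‖ * ‖a‖ ^ 2) := Real.sqrt_le_sqrt h3
      _ = _ := by rw [Real.sqrt_mul (norm_nonneg _), Real.sqrt_sq (norm_nonneg _)]
  obtain ⟨C, hC⟩ := eb
  let E : A →L[ℂ] H := e.mkContinuous C hC
  have bim : ∀ i j a x, (h i * k j) (π a x) = π a ((h i * k j) x) := by
    intro i j a x
    simp only [ContinuousLinearMap.mul_apply, (hb i).1, (kb j).1]
  have hθ : ∀ i j a b, ⟪e 1, (h i * k j) (e (star a * b))⟫_ℂ = ⟪e a, (h i * k j) (e b)⟫_ℂ := by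
    intro i j a b
    rw [← hπ, bim, ← hπs, hπ, mul_one]
  refine ⟨fun i j => (innerSL ℂ (e 1)) ∘L (h i * k j) ∘L E, ?_, ?_, ?_, ?_, ?_⟩
  · intro i j a
    change 0 ≤ ⟪e 1, (h i * k j) (e (star a * a))⟫_ℂ
    rw [hθ]
    have := pos i j
    rw [ContinuousLinearMap.nonneg_iff_isPositive] at this
    exact this.inner_nonneg_right _
  · intro i j a b
    change ⟪e 1, (h i * k j) (e (a * b))⟫_ℂ = ⟪e 1, (h i * k j) (e (b * a))⟫_ℂ
    have e1 := hθ i j (star a) b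
    have e2 := hθ i j (star b) a
    rw [star_star] at e1 e2
    rw [e1, e2, ← hJ, ← hJ, ← symm _ (pos i j), ← hJi]
    congr 1
    have hJJ : ∀ x, J (J x) = x := fun x => 
      he.induction_on (p := fun x => J (J x) = x) x
        (isClosed_eq (by fun_prop) (by fun_prop)) (fun a => by rw [hJ, hJ, star_star])
    simp only [ContinuousLinearMap.mul_apply, (hb i).2, (kb j).2, hJJ]
  · intro i j h0 a
    change ⟪e 1, (h i * k j) (e 1)⟫_ℂ = 0 at h0
    change ⟪e 1, (h i * k j) (e a)⟫_ℂ = 0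
    obtain ⟨S, hS⟩ := CStarAlgebra.nonneg_iff_eq_star_mul_self.mp (pos i j)
    rw [← symm _ (pos i j)]
    rw [hS, ContinuousLinearMap.star_eq_adjoint, ContinuousLinearMap.mul_apply] at h0 ⊢
    rw [ContinuousLinearMap.adjoint_inner_right, inner_self_eq_zero] at h0
    rw [h0]
    simp
  · intro i a
    change φ i a = ∑ j, ⟪e 1, (h i * k j) (e a)⟫_ℂ
    rw [← inner_sum, ← ContinuousLinearMap.sum_apply, ← Finset.mul_sum, ksum, mul_one, hh]
    simp
  · intro j a
    change ψ j a = ∑ i, ⟪e 1, (h i * k j) (e a)⟫_ℂ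
    rw [← inner_sum, ← ContinuousLinearMap.sum_apply, ← Finset.sum_mul, hsum, one_mul, kk]
    simp

/-- The tracial state space of a unital C*-algebra has the Riesz decomposition property
for proper convex combinations; in particular it is a (possibly empty) Choquet simplex. -/
theorem tracialStateSpace_rieszDecomposition
    {A : Type*} [NormedRing A] [StarRing A] [CStarRing A] [NormedAlgebra ℂ A]
    [StarModule ℂ A] [CompleteSpace A]
    (n m : ℕ) (α : Fin n → ℝ) (β : Fin m → ℝ)
    (τ : A →L[ℂ] ℂ) (τs : Fin n → A →L[ℂ] ℂ) (σs : Fin m → A →L[ℂ] ℂ)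
    (hτ : IsTracialState18 τ) (hτs : ∀ j, IsTracialState18 (τs j))
    (hσs : ∀ i, IsTracialState18 (σs i))
    (hα : ∀ j, 0 < α j) (hβ : ∀ i, 0 < β i)
    (hα1 : ∑ j, α j = 1) (hβ1 : ∑ i, β i = 1)
    (hconv1 : ∀ a : A, τ a = ∑ j, α j • τs j a)
    (hconv2 : ∀ a : A, τ a = ∑ i, β i • σs i a) :
    ∃ (γ : Fin m → Fin n → ℝ) (ρ : Fin m → Fin n → (A →L[ℂ] ℂ)),
      (∀ i j, 0 ≤ γ i j) ∧ (∀ i j, IsTracialState18 (ρ i j)) ∧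
      (∀ a : A, τ a = ∑ i, ∑ j, γ i j • ρ i j a) ∧
      (∀ j, α j = ∑ i, γ i j) ∧ (∀ i, β i = ∑ j, γ i j) ∧
      (∀ j, ∀ a : A, τs j a = ∑ i, ((α j)⁻¹ * γ i j) • ρ i j a) ∧
      (∀ i, ∀ a : A, σs i a = ∑ j, ((β i)⁻¹ * γ i j) • ρ i j a) := by
  letI : CStarAlgebra A := {}
  obtain ⟨θ, hpos, htr, hz, hs1, hs2⟩ := aux_main τ (fun i => β i • σs i) (fun j => α j • τs j)
    hτ.2.1 hτ.2.2 (fun i a => smul_nonneg (hβ i).le ((hσs i).2.1 a))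
    (fun i a b => congrArg (fun z : ℂ => β i • z) ((hσs i).2.2 a b))
    (fun i a => smul_nonneg (hα i).le ((hτs i).2.1 a))
    (fun i a b => congrArg (fun z : ℂ => α i • z) ((hτs i).2.2 a b))
    hconv2 hconv1
  have hre : ∀ i j, θ i j 1 = (((θ i j 1).re : ℝ) : ℂ) ∧ 0 ≤ (θ i j 1).re := by
    intro i j
    have h := hpos i j 1
    rw [star_one, one_mul, Complex.nonneg_iff] at h
    exact ⟨Complex.ext rfl (by simpa using h.2.symm), h.1⟩
  classical
  let γ : Fin m → Fin n → ℝ := fun i j => (θ i j 1).re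
  let ρ : Fin m → Fin n → (A →L[ℂ] ℂ) := fun i j =>
    if γ i j = 0 then τ else (γ i j)⁻¹ • θ i j
  have hγ0 : ∀ i j, 0 ≤ γ i j := fun i j => (hre i j).2
  have hγ1 : ∀ i j, θ i j 1 = (γ i j : ℂ) := fun i j => (hre i j).1
  have hγρ : ∀ i j a, γ i j • ρ i j a = θ i j a := by
    intro i j a
    by_cases h : γ i j = 0
    · rw [h, zero_smul, hz i j (by rw [hγ1, h, Complex.ofReal_zero])]
    · simp only [ρ, if_neg h]
      change γ i j • (γ i j)⁻¹ • θ i j a = _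
      rw [smul_smul, mul_inv_cancel₀ h, one_smul]
  refine ⟨γ, ρ, hγ0, ?_, ?_, ?_, ?_, ?_, ?_⟩
  · intro i j
    by_cases h : γ i j = 0
    · simpa only [ρ, if_pos h] using hτ
    · simp only [ρ, if_neg h]
      refine ⟨?_, fun a => smul_nonneg (inv_nonneg.2 (hγ0 i j)) (hpos i j a),
        fun a b => congrArg (fun z : ℂ => (γ i j)⁻¹ • z) (htr i j a b)⟩
      change (γ i j)⁻¹ • θ i j 1 = 1
      rw [hγ1, Complex.real_smul, ← Complex.ofReal_mul, inv_mul_cancel₀ h, Complex.ofReal_one]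
  · intro a
    rw [hconv2]
    refine Finset.sum_congr rfl fun i _ => ?_
    simp only [hγρ]
    exact hs1 i a
  · intro j
    have h : α j • τs j 1 = _ := hs2 j 1
    simp only [hγ1, (hτs j).1, Complex.real_smul, mul_one] at h
    exact_mod_cast h
  · intro i
    have h : β i • σs i 1 = _ := hs1 i 1
    simp only [hγ1, (hσs i).1, Complex.real_smul, mul_one] at h
    exact_mod_cast h
  · intro j a
    have h : α j • τs j a = _ := hs2 j a
    simp only [mul_smul, hγρ]
    rw [← Finset.smul_sum, ← h, smul_smul, inv_mul_cancel₀ (hα j).ne', one_smul]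
  · intro i a
    have h : β i • σs i a = _ := hs1 i a
    simp only [mul_smul, hγρ]
    rw [← Finset.smul_sum, ← h, smul_smul, inv_mul_cancel₀ (hβ i).ne', one_smul]
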